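/- Let u: ℝ → ℝ be an even C¹ function, compactly supported, with u(0) = u'(0) = 0 and u ≥ 0. Then −∫₀^∞ u(x) Hu(x) x^{-3} dx = (1/π) ( ∫₀^∞ u(x) x^{-2} dx )², where Hu is the Hilbert transform of u. -/

import Mathlib

open Real MeasureTheory Filter

/-- The Hilbert transform `Hu(x) = (1/π) p.v. ∫ u(y)/(x−y) dy`, realized as the limit of
truncated integrals. -/
noncomputable def hilbertT (u : ℝ → ℝ) (x : ℝ) : ℝ :=
  lim ((nhdsWithin (0:ℝ) (Set.Ioi 0)).map fun ε =>
    (1 / π) * ∫ y in {y : ℝ | ε ≤ |x - y|}, u y / (x - y))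

open Set Topology

/-- The kernel of the Hilbert transform of an even function after folding `(x, ∞)` onto `(0, x)`
by the inversion `y ↦ x ^ 2 / y`, in the variable `s = y / x`. -/
noncomputable def foldedDiff (u : ℝ → ℝ) (x s : ℝ) : ℝ :=
  (u (x / s) - u (x * s)) / (1 - s ^ 2)

lemma measurable_foldedDiff {u : ℝ → ℝ} (hc : Continuous u) :
    Measurable (Function.uncurry (foldedDiff u)) := by
  have := hc.measurable
  unfold foldedDiff Function.uncurry
  fun_prop

section Bounds

variable {u : ℝ → ℝ} {L x s : ℝ}

lemma abs_foldedDiff_le (hL : ∀ a b, |u a - u b| ≤ L * |a - b|) (h0 : u 0 = 0)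
    (hpos : ∀ a, 0 ≤ u a) (hx : 0 < x) (hs : s ∈ Ioo (0 : ℝ) 1) :
    |foldedDiff u x s| ≤ 2 * L * x + 2 * u (x / s) := by
  obtain ⟨hs0, hs1⟩ := hs
  have hd : 0 < 1 - s ^ 2 := by nlinarith
  have hL0 : 0 ≤ L := by simpa using (abs_nonneg _).trans (hL 1 0)
  have hLx : 0 ≤ L * x := by positivity
  have hu := hpos (x / s)
  rw [foldedDiff, abs_div, abs_of_pos hd, div_le_iff₀ hd]
  rcases le_or_gt (1 / 2) s with h | h
  · have h1 := hL (x / s) (x * s)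
    have h2 : x / s - x * s = x * (1 - s ^ 2) / s := by field_simp
    rw [h2, abs_of_nonneg (div_nonneg (mul_nonneg hx.le hd.le) hs0.le)] at h1
    have h3 : x * (1 - s ^ 2) / s ≤ 2 * x * (1 - s ^ 2) := by
      rw [div_le_iff₀ hs0]
      nlinarith [mul_pos hx hd]
    nlinarith [mul_le_mul_of_nonneg_left h3 hL0, mul_nonneg hu hd.le]
  · have h1 := hL (x * s) 0
    rw [h0, sub_zero, sub_zero, abs_of_nonneg (hpos _), abs_of_nonneg (by positivity)] at h1
    have h2 : |u (x / s) - u (x * s)| ≤ u (x / s) + u (x * s) := by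
      rw [abs_le]; constructor <;> linarith [hpos (x * s)]
    have h3 : 3 / 4 ≤ 1 - s ^ 2 := by nlinarith
    nlinarith [mul_le_mul_of_nonneg_left h3 hLx, mul_le_mul_of_nonneg_left h3 hu,
      mul_le_mul_of_nonneg_left h.le hLx]

lemma le_foldedDiff (hL : ∀ a b, |u a - u b| ≤ L * |a - b|) (h0 : u 0 = 0)
    (hpos : ∀ a, 0 ≤ u a) (hx : 0 < x) (hs : s ∈ Ioo (0 : ℝ) 1) :
    u (x / s) - 4 * L * x ≤ foldedDiff u x s := by
  obtain ⟨hs0, hs1⟩ := hs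
  have hd : 0 < 1 - s ^ 2 := by nlinarith
  have hL0 : 0 ≤ L := by simpa using (abs_nonneg _).trans (hL 1 0)
  have hLx : 0 ≤ L * x := by positivity
  have hu := hpos (x / s)
  rw [foldedDiff, le_div_iff₀ hd]
  rcases le_or_gt (1 / 2) s with h | h
  · have h1 := (abs_le.1 (hL (x / s) (x * s))).1
    have h2 : x / s - x * s = x * (1 - s ^ 2) / s := by field_simp
    rw [h2, abs_of_nonneg (div_nonneg (mul_nonneg hx.le hd.le) hs0.le)] at h1
    have h3 : x * (1 - s ^ 2) / s ≤ 2 * x * (1 - s ^ 2) := by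
      rw [div_le_iff₀ hs0]
      nlinarith [mul_pos hx hd]
    have h4 := (le_abs_self _).trans (hL (x / s) 0)
    rw [h0, sub_zero, sub_zero, abs_of_nonneg (by positivity)] at h4
    have h5 : x / s ≤ 2 * x := by
      rw [div_le_iff₀ hs0]
      nlinarith
    nlinarith [mul_le_mul_of_nonneg_left h3 hL0, mul_le_mul_of_nonneg_left h5 hL0,
      mul_nonneg hLx hd.le]
  · have h1 := hL (x * s) 0
    rw [h0, sub_zero, sub_zero, abs_of_nonneg (hpos _), abs_of_nonneg (by positivity)] at h1
    have h3 : 3 / 4 ≤ 1 - s ^ 2 := by nlinarith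
    nlinarith [mul_le_mul_of_nonneg_left h3 hLx, mul_nonneg hu (sq_nonneg s),
      mul_le_mul_of_nonneg_left h.le hLx]

end Bounds

lemma integrableOn_foldedDiff {u : ℝ → ℝ} {L : ℝ} (hc : Continuous u) (hs : HasCompactSupport u)
    (hL : ∀ a b, |u a - u b| ≤ L * |a - b|) (h0 : u 0 = 0) (hpos : ∀ a, 0 ≤ u a) {x : ℝ}
    (hx : 0 < x) : IntegrableOn (foldedDiff u x) (Ioo 0 1) := by
  obtain ⟨C, hC⟩ := hc.bounded_above_of_compact_support hs
  refine Measure.integrableOn_of_bounded (M := 2 * L * x + 2 * C) (by simp)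
    ((measurable_foldedDiff hc).of_uncurry_left.aestronglyMeasurable) ?_
  filter_upwards [ae_restrict_mem measurableSet_Ioo] with s hs
  have := (le_abs_self _).trans (hC (x / s))
  exact (abs_foldedDiff_le hL h0 hpos hx hs).trans (by linarith)

lemma setIntegral_Ioo_eq_setIntegral_Ioi_comp_div {x c : ℝ} (hx : 0 < x) (hc : 0 < c)
    (g : ℝ → ℝ) :
    ∫ s in Ioo 0 c, g s = ∫ y in Ioi (x / c), x / y ^ 2 * g (x / y) := by
  have hpos : ∀ y ∈ Ioi (x / c), 0 < y := fun y hy => (div_pos hx hc).trans hy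
  have himg : (fun y => x / y) '' Ioi (x / c) = Ioo 0 c := by
    ext s
    constructor
    · rintro ⟨y, hy, rfl⟩
      have hy0 := hpos y hy
      refine ⟨by positivity, ?_⟩
      rw [mem_Ioi, div_lt_iff₀ hc] at hy
      change x / y < c
      rwa [div_lt_iff₀ hy0, mul_comm]
    · rintro ⟨h1, h2⟩
      exact ⟨x / s, div_lt_div_of_pos_left hx h1 h2, by field_simp⟩
  have hderiv : ∀ y ∈ Ioi (x / c),
      HasDerivWithinAt (fun y => x / y) (-x / y ^ 2) (Ioi (x / c)) y := fun y hy => by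
    have := ((hasDerivAt_const y x).div (hasDerivAt_id y) (hpos y hy).ne').hasDerivWithinAt
      (s := Ioi (x / c))
    simp only [id, zero_mul, mul_one, zero_sub] at this
    exact this
  have hinj : InjOn (fun y => x / y) (Ioi (x / c)) := fun y hy z hz h => by
    have := (hpos y hy).ne'
    have := (hpos z hz).ne'
    field_simp at h
    exact h.symm
  rw [← himg, integral_image_eq_integral_abs_deriv_smul measurableSet_Ioi hderiv hinj]
  refine setIntegral_congr_fun measurableSet_Ioi fun y hy => ?_
  simp only [smul_eq_mul]
  rw [abs_div, abs_neg, abs_of_pos hx, abs_of_nonneg (sq_nonneg y)]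

lemma integrableOn_div_of_le_abs {u d : ℝ → ℝ} {S : Set ℝ} {c : ℝ} (hu : Integrable u)
    (hd : Measurable d) (hS : MeasurableSet S) (hc : 0 < c) (h : ∀ y ∈ S, c ≤ |d y|) :
    IntegrableOn (fun y => u y / d y) S := by
  refine Integrable.mono' (hu.norm.div_const c).integrableOn
    (hu.aestronglyMeasurable.restrict.mul hd.inv.aestronglyMeasurable) ?_
  filter_upwards [ae_restrict_mem hS] with y hy
  rw [norm_div]
  exact div_le_div_of_nonneg_left (norm_nonneg _) hc (h y hy)

/-- The symmetric truncation of the principal value integral, and the truncation which is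
symmetric for `y ↦ x ^ 2 / y`, differ by integrals over short intervals. -/
lemma truncated_integral_eq {u : ℝ → ℝ} (hc : Continuous u) (hs : HasCompactSupport u)
    (heven : ∀ y, u (-y) = u y) {x ε : ℝ} (hε : 0 < ε) (hεx : ε < x) :
    ∫ y in {y : ℝ | ε ≤ |x - y|}, u y / (x - y) =
      -2 * (∫ s in Ioo 0 ((x - ε) / x), foldedDiff u x s) +
        ((∫ y in Ioc (x - ε) (x ^ 2 / (x - ε)), u y / (x + y)) +
          ∫ y in Ioc (x + ε) (x ^ 2 / (x - ε)), u y / (x - y)) := by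
  have hx : 0 < x := hε.trans hεx
  have ha : 0 < x - ε := sub_pos.2 hεx
  set a := x - ε with ha_def
  set b := x ^ 2 / a with hb_def
  have hxb : x + ε ≤ b := by
    rw [hb_def, le_div_iff₀ ha, ha_def]; nlinarith [sq_nonneg ε]
  have hab : a ≤ b := by linarith
  have hui : Integrable u := hc.integrable_of_hasCompactSupport hs
  have hg : ∀ S, MeasurableSet S → (∀ y ∈ S, ε ≤ |x - y|) →
      IntegrableOn (fun y => u y / (x - y)) S := fun S hS h =>
    integrableOn_div_of_le_abs hui (by fun_prop) hS hε h
  have hp : IntegrableOn (fun y => u y / (x + y)) (Ioi 0) :=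
    integrableOn_div_of_le_abs hui (by fun_prop) measurableSet_Ioi hx fun y hy => by
      rw [mem_Ioi] at hy
      rw [abs_of_pos (by linarith)]; linarith
  have hgl : IntegrableOn (fun y => u y / (x - y)) (Iic a) := hg _ measurableSet_Iic
    fun y hy => by rw [mem_Iic] at hy; exact le_abs.2 (.inl (by linarith))
  have hgr : IntegrableOn (fun y => u y / (x - y)) (Ioi (x + ε)) := hg _ measurableSet_Ioi
    fun y hy => by rw [mem_Ioi] at hy; exact le_abs.2 (.inr (by linarith))
  have hset : {y : ℝ | ε ≤ |x - y|} = Iic a ∪ Ici (x + ε) := by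
    ext y
    simp only [mem_ofPred_eq, le_abs, mem_union, mem_Iic, mem_Ici]
    constructor <;> rintro (h | h) <;> [left; right; left; right] <;> linarith
  have hT : ∫ y in {y : ℝ | ε ≤ |x - y|}, u y / (x - y) =
      (∫ y in Iic a, u y / (x - y)) + ∫ y in Ioi (x + ε), u y / (x - y) := by
    rw [hset, setIntegral_union _ measurableSet_Ici hgl ((integrableOn_Ici_iff_integrableOn_Ioi (by simp)).2 hgr),
      integral_Ici_eq_integral_Ioi]
    exact (Iic_disjoint_Ioi (by linarith : a ≤ a)).mono_right fun y hy => by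
      rw [mem_Ici] at hy; rw [mem_Ioi]; linarith
  have hleft : ∫ y in Iic a, u y / (x - y) =
      (∫ y in Iic 0, u y / (x - y)) + ∫ y in Ioc 0 a, u y / (x - y) := by
    rw [← Iic_union_Ioc_eq_Iic ha.le, setIntegral_union (Iic_disjoint_Ioc le_rfl) measurableSet_Ioc
      (hgl.mono_set (Iic_subset_Iic.2 ha.le)) (hgl.mono_set Ioc_subset_Iic_self)]
  have hneg : ∫ y in Iic 0, u y / (x - y) = ∫ y in Ioi 0, u y / (x + y) := by
    have := integral_comp_neg_Iic 0 (fun y => u y / (x + y))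
    simpa [heven, sub_eq_add_neg] using this
  have hpsplit : ∫ y in Ioi 0, u y / (x + y) = (∫ y in Ioc 0 a, u y / (x + y)) +
      ((∫ y in Ioc a b, u y / (x + y)) + ∫ y in Ioi b, u y / (x + y)) := by
    have h1 : IntegrableOn (fun y => u y / (x + y)) (Ioi a) := hp.mono_set (Ioi_subset_Ioi ha.le)
    rw [← Ioc_union_Ioi_eq_Ioi ha.le, setIntegral_union (Ioc_disjoint_Ioi le_rfl) measurableSet_Ioi
      (hp.mono_set Ioc_subset_Ioi_self) h1, ← Ioc_union_Ioi_eq_Ioi hab,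
      setIntegral_union (Ioc_disjoint_Ioi le_rfl) measurableSet_Ioi
      (h1.mono_set Ioc_subset_Ioi_self) (h1.mono_set (Ioi_subset_Ioi hab))]
  have hgsplit : ∫ y in Ioi (x + ε), u y / (x - y) =
      (∫ y in Ioc (x + ε) b, u y / (x - y)) + ∫ y in Ioi b, u y / (x - y) := by
    rw [← Ioc_union_Ioi_eq_Ioi hxb, setIntegral_union (Ioc_disjoint_Ioi le_rfl) measurableSet_Ioi
      (hgr.mono_set Ioc_subset_Ioi_self) (hgr.mono_set (Ioi_subset_Ioi hxb))]
  have hlam : 0 < a / x := by positivity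
  have hlam1 : a / x < 1 := by rw [div_lt_one hx]; linarith
  have hden : ∀ s ∈ Ioo 0 (a / x), ε / x ≤ |1 - s ^ 2| := fun s hs => by
    have h1 : ε / x = 1 - a / x := by rw [ha_def]; field_simp; ring
    rw [h1]
    refine le_trans ?_ (le_abs_self _)
    nlinarith [hs.1, hs.2]
  have hDl : IntegrableOn (fun s => u (x * s) / (1 - s ^ 2)) (Ioo 0 (a / x)) := by
    refine integrableOn_div_of_le_abs ?_ (by fun_prop) measurableSet_Ioo (div_pos hε hx) hden
    exact hui.comp_mul_left' hx.ne'
  have hDr : IntegrableOn (fun s => u (x / s) / (1 - s ^ 2)) (Ioo 0 (a / x)) := by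
    obtain ⟨C, hC⟩ := hc.bounded_above_of_compact_support hs
    have hm := hc.measurable
    refine Measure.integrableOn_of_bounded (M := C / (ε / x)) (by simp)
      (Measurable.aestronglyMeasurable (by fun_prop)) ?_
    filter_upwards [ae_restrict_mem measurableSet_Ioo] with s hs
    rw [norm_div]
    exact div_le_div₀ ((norm_nonneg _).trans (hC 0)) (hC _) (div_pos hε hx) (hden s hs)
  have hD : ∫ s in Ioo 0 (a / x), foldedDiff u x s =
      (∫ s in Ioo 0 (a / x), u (x / s) / (1 - s ^ 2)) -
        ∫ s in Ioo 0 (a / x), u (x * s) / (1 - s ^ 2) := by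
    rw [← integral_sub hDr hDl]
    simp only [foldedDiff, sub_div]
  have hL : 2 * ∫ s in Ioo 0 (a / x), u (x * s) / (1 - s ^ 2) =
      (∫ y in Ioc 0 a, u y / (x - y)) + ∫ y in Ioc 0 a, u y / (x + y) := by
    rw [← integral_add (hgl.mono_set Ioc_subset_Iic_self) (hp.mono_set Ioc_subset_Ioi_self),
      ← integral_const_mul, ← integral_Ioc_eq_integral_Ioo,
      ← intervalIntegral.integral_of_le hlam.le, ← intervalIntegral.integral_of_le ha.le]
    have h := intervalIntegral.integral_comp_mul_left (a := 0) (b := a / x)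
      (fun y => u y / (x - y) + u y / (x + y)) hx.ne'
    rw [smul_eq_mul, mul_zero, mul_div_cancel₀ _ hx.ne', eq_inv_mul_iff_mul_eq₀ hx.ne'] at h
    rw [← h, ← intervalIntegral.integral_const_mul]
    refine intervalIntegral.integral_congr fun s hs => ?_
    rw [uIcc_of_le hlam.le] at hs
    have h1 : 0 < 1 - s := by linarith [hs.2]
    have h2 : 0 < 1 + s := by linarith [hs.1]
    have h3 : x - x * s = x * (1 - s) := by ring
    have h4 : x + x * s = x * (1 + s) := by ring
    have h5 : 1 - s ^ 2 = (1 - s) * (1 + s) := by ring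
    simp only [h3, h4, h5]
    field_simp
    ring
  have hR : -2 * ∫ s in Ioo 0 (a / x), u (x / s) / (1 - s ^ 2) =
      (∫ y in Ioi b, u y / (x - y)) + ∫ y in Ioi b, u y / (x + y) := by
    have hb : x / (a / x) = b := by rw [hb_def]; field_simp
    rw [← integral_add (hgr.mono_set (Ioi_subset_Ioi hxb))
      (hp.mono_set (Ioi_subset_Ioi (by linarith))),
      setIntegral_Ioo_eq_setIntegral_Ioi_comp_div hx hlam, hb, ← integral_const_mul]
    refine setIntegral_congr_fun measurableSet_Ioi fun y hy => ?_
    rw [mem_Ioi] at hy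
    have h1 : 0 < y - x := by linarith
    have h2 : 0 < x + y := by linarith
    have hy0 : 0 < y := by linarith
    have h3 : x - y = -(y - x) := by ring
    have h4 : 1 - (x / y) ^ 2 = (y - x) * (x + y) / y ^ 2 := by field_simp; ring
    have h5 : x / (x / y) = y := by field_simp
    simp only [h3, h4, h5]
    field_simp
    ring
  rw [hT, hleft, hneg, hpsplit, hgsplit, hD]
  linarith

lemma hilbertT_eq {u : ℝ → ℝ} {L : ℝ} (hc : Continuous u) (hs : HasCompactSupport u)
    (heven : ∀ y, u (-y) = u y) (hL : ∀ a b, |u a - u b| ≤ L * |a - b|) (h0 : u 0 = 0)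
    (hpos : ∀ a, 0 ≤ u a) {x : ℝ} (hx : 0 < x) :
    hilbertT u x = -(2 / π) * ∫ s in Ioo 0 1, foldedDiff u x s := by
  obtain ⟨C, hC⟩ := hc.bounded_above_of_compact_support hs
  have hC0 : 0 ≤ C := (norm_nonneg _).trans (hC 0)
  refine Tendsto.limUnder_eq ?_
  have hmain : Tendsto (fun ε => ∫ s in Ioo 0 ((x - ε) / x), foldedDiff u x s) (𝓝[>] 0)
      (𝓝 (∫ s in Ioo 0 1, foldedDiff u x s)) := by
    have hint : IntegrableOn (foldedDiff u x) (Icc 0 1) :=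
      (integrableOn_Icc_iff_integrableOn_Ioo (by simp) (by simp)).2
        (integrableOn_foldedDiff hc hs hL h0 hpos hx)
    have h1 := intervalIntegral.continuousOn_primitive hint 1 (by simp)
    simp only [ContinuousWithinAt, integral_Ioc_eq_integral_Ioo] at h1
    refine h1.comp (tendsto_nhdsWithin_iff.2 ⟨?_, ?_⟩)
    · have : ContinuousAt (fun ε => (x - ε) / x) 0 := by fun_prop
      have := this.tendsto
      rw [sub_zero, div_self hx.ne'] at this
      exact this.mono_left nhdsWithin_le_nhds
    · filter_upwards [Ioo_mem_nhdsGT hx] with ε hε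
      exact ⟨div_nonneg (by linarith [hε.2]) hx.le, (div_le_one hx).2 (by linarith [hε.1])⟩
  have herr : Tendsto (fun ε => (∫ y in Ioc (x - ε) (x ^ 2 / (x - ε)), u y / (x + y)) +
      ∫ y in Ioc (x + ε) (x ^ 2 / (x - ε)), u y / (x - y)) (𝓝[>] 0) (𝓝 0) := by
    have hbd : Tendsto (fun ε => C / x * (x ^ 2 / (x - ε) - (x - ε)) + C * (ε / (x - ε)))
        (𝓝[>] 0) (𝓝 0) := by
      have : ContinuousAt
          (fun ε => C / x * (x ^ 2 / (x - ε) - (x - ε)) + C * (ε / (x - ε))) 0 := by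
        have : x - 0 ≠ 0 := by simpa using hx.ne'
        fun_prop (disch := assumption)
      have := this.tendsto
      have h2 : C / x * (x ^ 2 / (x - 0) - (x - 0)) + C * (0 / (x - 0)) = 0 := by
        field_simp
        simp
      rw [h2] at this
      exact this.mono_left nhdsWithin_le_nhds
    refine squeeze_zero_norm' ?_ hbd
    filter_upwards [Ioo_mem_nhdsGT hx] with ε hε
    obtain ⟨hε0, hεx⟩ := hε
    have ha : 0 < x - ε := sub_pos.2 hεx
    have hxb : x + ε ≤ x ^ 2 / (x - ε) := by
      rw [le_div_iff₀ ha]; nlinarith [sq_nonneg ε]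
    refine (norm_add_le _ _).trans (add_le_add ?_ ?_)
    · refine (norm_setIntegral_le_of_norm_le_const (C := C / x) (by simp) fun y hy => ?_).trans ?_
      · rw [norm_div, Real.norm_eq_abs (x + y), abs_of_pos (by linarith [hy.1])]
        exact div_le_div₀ hC0 (hC _) hx (by linarith [hy.1])
      · rw [Real.volume_real_Ioc_of_le (by linarith)]
    · refine (norm_setIntegral_le_of_norm_le_const (C := C / ε) (by simp) fun y hy => ?_).trans ?_
      · rw [norm_div, Real.norm_eq_abs (x - y)]
        exact div_le_div₀ hC0 (hC _) hε0 (le_abs.2 (.inr (by linarith [hy.1])))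
      · rw [Real.volume_real_Ioc_of_le hxb]
        apply le_of_eq
        field_simp
        ring
  have hlim := ((hmain.const_mul (-2)).add herr).const_mul (1 / π)
  have hval : 1 / π * (-2 * (∫ s in Ioo 0 1, foldedDiff u x s) + 0) =
      -(2 / π) * ∫ s in Ioo 0 1, foldedDiff u x s := by ring
  rw [hval] at hlim
  refine hlim.congr' ?_
  filter_upwards [Ioo_mem_nhdsGT hx] with ε hε
  rw [truncated_integral_eq hc hs heven hε.1 hε.2]

lemma two_mul_setIntegral_mul_tail {f : ℝ → ℝ} {a : ℝ} (hf : IntegrableOn f (Ioi a)) :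
    2 * ∫ x in Ioi a, f x * ∫ y in Ioi x, f y = (∫ x in Ioi a, f x) ^ 2 := by
  set μ := (volume : Measure ℝ).restrict (Ioi a) with hμ
  have hint : Integrable (Function.uncurry fun x y => (Ioi x).indicator (fun y => f x * f y) y)
      (μ.prod μ) :=
    (Integrable.mul_prod hf hf).indicator (measurableSet_lt measurable_fst measurable_snd)
  have htail : ∀ x ∈ Ioi a, ∫ y, (Ioi x).indicator (fun y => f x * f y) y ∂μ =
      f x * ∫ y in Ioi x, f y := fun x hx => by
    rw [integral_indicator measurableSet_Ioi, hμ, Measure.restrict_restrict measurableSet_Ioi,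
      inter_eq_left.2 (Ioi_subset_Ioi (le_of_lt hx)), integral_const_mul]
  have hhead : ∀ x ∈ Ioi a, ∫ y, (Ioi y).indicator (fun z => f y * f z) x ∂μ =
      (∫ y in Ioi a, f y) * f x - f x * ∫ y in Ioi x, f y := fun x hx => by
    have h1 : (fun y => (Ioi y).indicator (fun z => f y * f z) x) =
        (Iio x).indicator fun y => f y * f x := by
      ext y
      simp [indicator_apply]
    have h2 := intervalIntegral.integral_interval_add_Ioi (a := a) (b := x) hf
      (hf.mono_set (Ioi_subset_Ioi (le_of_lt hx)))
    rw [intervalIntegral.integral_of_le (le_of_lt hx), integral_Ioc_eq_integral_Ioo] at h2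
    rw [h1, integral_indicator measurableSet_Iio, hμ, Measure.restrict_restrict measurableSet_Iio,
      Iio_inter_Ioi, integral_mul_const, ← h2]
    ring
  have hJ := integral_integral_swap hint
  rw [setIntegral_congr_fun measurableSet_Ioi htail,
    setIntegral_congr_fun measurableSet_Ioi hhead] at hJ
  have hJi : Integrable (fun x => f x * ∫ y in Ioi x, f y) μ :=
    hint.integral_prod_left.congr <| by
      filter_upwards [ae_restrict_mem measurableSet_Ioi] with x hx using htail x hx
  rw [integral_sub (hf.const_mul _) hJi, integral_const_mul] at hJ
  rw [sq]
  linarith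

section Weighted

variable {u : ℝ → ℝ} {L : ℝ}

lemma integrableOn_Ioo_comp_div (hc : Continuous u) (hs : HasCompactSupport u) (x : ℝ) :
    IntegrableOn (fun s => u (x / s)) (Ioo 0 1) := by
  obtain ⟨C, hC⟩ := hc.bounded_above_of_compact_support hs
  have hm := hc.measurable
  exact Measure.integrableOn_of_bounded (M := C) (by simp)
    (Measurable.aestronglyMeasurable (by fun_prop)) (ae_of_all _ fun s => hC _)

lemma setIntegral_Ioo_comp_div {x : ℝ} (hx : 0 < x) :
    ∫ s in Ioo 0 1, u (x / s) = x * ∫ y in Ioi x, u y / y ^ 2 := by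
  rw [setIntegral_Ioo_eq_setIntegral_Ioi_comp_div hx one_pos, div_one, ← integral_const_mul]
  refine setIntegral_congr_fun measurableSet_Ioi fun y hy => ?_
  have : x / (x / y) = y := by field_simp
  simp only [this]
  ring

lemma integrable_prod_mul_comp_div (hc : Continuous u) (hs : HasCompactSupport u)
    (hpos : ∀ a, 0 ≤ u a) (hv : IntegrableOn (fun x => u x / x ^ 2) (Ioi 0)) :
    Integrable (Function.uncurry fun x s => u x / x ^ 2 / x * u (x / s))
      ((volume.restrict (Ioi 0)).prod (volume.restrict (Ioo 0 1))) := by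
  have hm := hc.measurable
  have hmeas : AEStronglyMeasurable (Function.uncurry fun x s => u x / x ^ 2 / x * u (x / s))
      (((volume : Measure ℝ).restrict (Ioi 0)).prod ((volume : Measure ℝ).restrict (Ioo 0 1))) :=
    Measurable.aestronglyMeasurable (by unfold Function.uncurry; fun_prop)
  refine (integrable_prod_iff hmeas).2
    ⟨ae_of_all _ fun x => (integrableOn_Ioo_comp_div hc hs x).const_mul (u x / x ^ 2 / x), ?_⟩
  refine Integrable.mono' (hv.mul_const (∫ y in Ioi 0, u y / y ^ 2))
    hmeas.norm.integral_prod_right' ?_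
  filter_upwards [ae_restrict_mem measurableSet_Ioi] with x hx
  rw [mem_Ioi] at hx
  have hvx : 0 ≤ u x / x ^ 2 := div_nonneg (hpos x) (sq_nonneg x)
  have h1 : ∀ s, ‖Function.uncurry (fun x s => u x / x ^ 2 / x * u (x / s)) (x, s)‖ =
      u x / x ^ 2 / x * u (x / s) := fun s =>
    Real.norm_of_nonneg (mul_nonneg (div_nonneg hvx hx.le) (hpos _))
  simp only [h1]
  rw [integral_const_mul, setIntegral_Ioo_comp_div hx, ← mul_assoc, div_mul_cancel₀ _ hx.ne',
    Real.norm_of_nonneg (mul_nonneg hvx (setIntegral_nonneg measurableSet_Ioi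
      fun y _ => div_nonneg (hpos y) (sq_nonneg y)))]
  refine mul_le_mul_of_nonneg_left (setIntegral_mono_set hv ?_
    (Ioi_subset_Ioi hx.le).eventuallyLE) hvx
  exact ae_of_all _ fun y => div_nonneg (hpos y) (sq_nonneg y)

lemma integrable_prod_mul_foldedDiff (hc : Continuous u) (hs : HasCompactSupport u)
    (hL : ∀ a b, |u a - u b| ≤ L * |a - b|) (h0 : u 0 = 0) (hpos : ∀ a, 0 ≤ u a)
    (hv : IntegrableOn (fun x => u x / x ^ 2) (Ioi 0)) :
    Integrable (Function.uncurry fun x s => u x / x ^ 2 / x * foldedDiff u x s)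
      ((volume.restrict (Ioi 0)).prod (volume.restrict (Ioo 0 1))) := by
  have hm := hc.measurable
  have hone : IntegrableOn (fun _ : ℝ => (1 : ℝ)) (Ioo 0 1) := by simp
  have hbound := ((Integrable.mul_prod hv hone).const_mul (2 * L)).add
    ((integrable_prod_mul_comp_div hc hs hpos hv).const_mul 2)
  refine Integrable.mono' hbound (Measurable.aestronglyMeasurable ?_) ?_
  · unfold Function.uncurry foldedDiff
    fun_prop
  · rw [Measure.prod_restrict]
    filter_upwards [ae_restrict_mem (measurableSet_Ioi.prod measurableSet_Ioo)] with ⟨x, s⟩ hxs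
    obtain ⟨hx, hs⟩ := hxs
    simp only [mem_Ioi] at hx
    have h1 : 0 ≤ u x / x ^ 2 / x := div_nonneg (div_nonneg (hpos x) (sq_nonneg x)) hx.le
    simp only [Function.uncurry, Pi.add_apply, norm_mul, Real.norm_eq_abs, abs_of_nonneg h1]
    refine (mul_le_mul_of_nonneg_left (abs_foldedDiff_le hL h0 hpos hx hs) h1).trans_eq ?_
    field_simp

lemma integrableOn_mul_comp_mul (hc : Continuous u)
    (hL : ∀ a b, |u a - u b| ≤ L * |a - b|) (h0 : u 0 = 0) (hpos : ∀ a, 0 ≤ u a)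
    (hv : IntegrableOn (fun x => u x / x ^ 2) (Ioi 0)) {c : ℝ} (hc0 : 0 < c) :
    IntegrableOn (fun x => u x / x ^ 2 / x * u (x * c)) (Ioi 0) := by
  have hm := hc.measurable
  refine Integrable.mono' (hv.mul_const (L * c)) (Measurable.aestronglyMeasurable (by fun_prop)) ?_
  filter_upwards [ae_restrict_mem measurableSet_Ioi] with x hx
  rw [mem_Ioi] at hx
  have h1 : 0 ≤ u x / x ^ 2 / x := div_nonneg (div_nonneg (hpos x) (sq_nonneg x)) hx.le
  have h2 := (le_abs_self _).trans (hL (x * c) 0)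
  rw [h0, sub_zero, sub_zero, abs_of_pos (by positivity)] at h2
  rw [Real.norm_of_nonneg (mul_nonneg h1 (hpos _))]
  refine (mul_le_mul_of_nonneg_left h2 h1).trans_eq ?_
  field_simp

lemma setIntegral_mul_foldedDiff (hc : Continuous u)
    (hL : ∀ a b, |u a - u b| ≤ L * |a - b|) (h0 : u 0 = 0) (hpos : ∀ a, 0 ≤ u a)
    (hv : IntegrableOn (fun x => u x / x ^ 2) (Ioi 0)) {s : ℝ} (hs : s ∈ Ioo (0 : ℝ) 1) :
    ∫ x in Ioi 0, u x / x ^ 2 / x * foldedDiff u x s =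
      ∫ x in Ioi 0, u x / x ^ 2 / x * u (x / s) := by
  obtain ⟨hs0, hs1⟩ := hs
  have hd : 1 - s ^ 2 ≠ 0 := by nlinarith
  have hA := integrableOn_mul_comp_mul hc hL h0 hpos hv hs0
  have hB := integrableOn_mul_comp_mul hc hL h0 hpos hv (inv_pos.2 hs0)
  simp only [← div_eq_mul_inv] at hB
  have hscale := integral_comp_mul_left_Ioi (fun x => u x / x ^ 2 / x * u (x / s)) 0 hs0
  rw [mul_zero, smul_eq_mul, eq_inv_mul_iff_mul_eq₀ hs0.ne'] at hscale
  have hAB : ∫ x in Ioi 0, u x / x ^ 2 / x * u (x * s) =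
      s ^ 2 * ∫ x in Ioi 0, u x / x ^ 2 / x * u (x / s) := by
    rw [← hscale, ← mul_assoc, ← integral_const_mul]
    refine setIntegral_congr_fun measurableSet_Ioi fun x hx => ?_
    rw [mem_Ioi] at hx
    have : s * x / s = x := by field_simp
    simp only [this, mul_comm x s]
    field_simp
  have hsplit : ∀ x, u x / x ^ 2 / x * foldedDiff u x s =
      (u x / x ^ 2 / x * u (x / s) - u x / x ^ 2 / x * u (x * s)) / (1 - s ^ 2) := fun x => by
    rw [foldedDiff]; ring
  simp only [hsplit]
  rw [integral_div, integral_sub hB hA, hAB, div_eq_iff hd]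
  ring

lemma setIntegral_setIntegral_mul_foldedDiff (hc : Continuous u) (hs : HasCompactSupport u)
    (hL : ∀ a b, |u a - u b| ≤ L * |a - b|) (h0 : u 0 = 0) (hpos : ∀ a, 0 ≤ u a)
    (hv : IntegrableOn (fun x => u x / x ^ 2) (Ioi 0)) :
    2 * ∫ x in Ioi 0, u x / x ^ 2 / x * ∫ s in Ioo 0 1, foldedDiff u x s =
      (∫ x in Ioi 0, u x / x ^ 2) ^ 2 := by
  rw [← two_mul_setIntegral_mul_tail hv]
  congr 1
  simp only [← integral_const_mul]
  rw [integral_integral_swap (integrable_prod_mul_foldedDiff hc hs hL h0 hpos hv),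
    setIntegral_congr_fun measurableSet_Ioo fun s hs =>
      setIntegral_mul_foldedDiff hc hL h0 hpos hv hs,
    ← integral_integral_swap (integrable_prod_mul_comp_div hc hs hpos hv)]
  refine setIntegral_congr_fun measurableSet_Ioi fun x hx => ?_
  rw [mem_Ioi] at hx
  simp only [integral_const_mul]
  rw [setIntegral_Ioo_comp_div hx, ← mul_assoc, div_mul_cancel₀ _ hx.ne']

lemma integrableOn_div_sq_Ioi (hc : Continuous u) (hs : HasCompactSupport u) {δ : ℝ}
    (hδ : 0 < δ) : IntegrableOn (fun x => u x / x ^ 2) (Ioi δ) :=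
  integrableOn_div_of_le_abs (hc.integrable_of_hasCompactSupport hs) (by fun_prop)
    measurableSet_Ioi (sq_pos_of_pos hδ) fun y hy => by
      rw [mem_Ioi] at hy
      rw [abs_of_nonneg (sq_nonneg y)]
      gcongr

/-- If the tails of `u x / x ^ 2` blow up at `0`, the folded integrals dominate `u x / x ^ 2`
near `0`. -/
lemma integrableOn_div_sq_of_integrableOn_mul_foldedDiff (hc : Continuous u)
    (hs : HasCompactSupport u) (hL : ∀ a b, |u a - u b| ≤ L * |a - b|) (h0 : u 0 = 0)
    (hpos : ∀ a, 0 ≤ u a)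
    (hF : IntegrableOn (fun x => u x / x ^ 2 / x * ∫ s in Ioo 0 1, foldedDiff u x s) (Ioi 0)) :
    IntegrableOn (fun x => u x / x ^ 2) (Ioi 0) := by
  have hv0 : ∀ x, 0 ≤ u x / x ^ 2 := fun x => div_nonneg (hpos x) (sq_nonneg x)
  by_cases! hδ : ∃ δ > 0, 4 * L + 1 ≤ ∫ y in Ioi δ, u y / y ^ 2
  · obtain ⟨δ, hδ, hP⟩ := hδ
    rw [← Ioc_union_Ioi_eq_Ioi hδ.le]
    refine IntegrableOn.union ?_ (integrableOn_div_sq_Ioi hc hs hδ)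
    have hm := hc.measurable
    refine Integrable.mono' (hF.mono_set Ioc_subset_Ioi_self)
      (Measurable.aestronglyMeasurable (by fun_prop)) ?_
    filter_upwards [ae_restrict_mem measurableSet_Ioc] with x hx
    obtain ⟨hx0, hxδ⟩ := hx
    rw [Real.norm_of_nonneg (hv0 x)]
    have h1 : ∫ y in Ioi δ, u y / y ^ 2 ≤ ∫ y in Ioi x, u y / y ^ 2 :=
      setIntegral_mono_set (integrableOn_div_sq_Ioi hc hs hx0) (ae_of_all _ hv0)
        (Ioi_subset_Ioi hxδ).eventuallyLE
    have hconst : IntegrableOn (fun _ : ℝ => 4 * L * x) (Ioo 0 1) :=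
      integrableOn_const (by simp)
    have h2 : ∫ s in Ioo 0 1, (u (x / s) - 4 * L * x) ≤ ∫ s in Ioo 0 1, foldedDiff u x s :=
      setIntegral_mono_on ((integrableOn_Ioo_comp_div hc hs x).sub hconst)
        (integrableOn_foldedDiff hc hs hL h0 hpos hx0) measurableSet_Ioo
        fun s hs => le_foldedDiff hL h0 hpos hx0 hs
    rw [integral_sub (integrableOn_Ioo_comp_div hc hs x) hconst, setIntegral_Ioo_comp_div hx0] at h2
    simp only [integral_const, measureReal_restrict_apply_univ, Real.volume_real_Ioo, sub_zero,
      zero_le_one, sup_of_le_left, one_smul] at h2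
    have h3 : x ≤ ∫ s in Ioo 0 1, foldedDiff u x s := by nlinarith
    calc u x / x ^ 2 = u x / x ^ 2 / x * x := by field_simp
      _ ≤ _ := mul_le_mul_of_nonneg_left h3 (div_nonneg (hv0 x) hx0.le)
  · refine (aecover_Ioi_of_Ioi tendsto_one_div_add_atTop_nhds_zero_nat
      ).integrable_of_integral_norm_bounded (4 * L + 1)
      (fun n => ?_) (Eventually.of_forall fun n => ?_)
    · exact (integrableOn_div_sq_Ioi hc hs Nat.one_div_pos_of_nat).mono_measure
        Measure.restrict_le_self
    · rw [Measure.restrict_restrict measurableSet_Ioi,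
        inter_eq_left.2 (Ioi_subset_Ioi Nat.one_div_pos_of_nat.le)]
      simp only [Real.norm_of_nonneg (hv0 _)]
      exact (hδ _ Nat.one_div_pos_of_nat).le

end Weighted

/-- For `u` even, `C¹`, compactly supported, with `u(0) = u'(0) = 0` and `u ≥ 0`,
`−∫₀^∞ u(x) Hu(x) x^{-3} dx = (1/π)(∫₀^∞ u(x) x^{-2} dx)²`. -/
theorem stmt_10 (u : ℝ → ℝ) (hu : ContDiff ℝ 1 u) (heven : ∀ x, u (-x) = u x)
    (hsupp : HasCompactSupport u) (h0 : u 0 = 0) (h0' : deriv u 0 = 0)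
    (hpos : ∀ x, 0 ≤ u x) :
    -∫ x in Set.Ioi (0:ℝ), u x * hilbertT u x * x ^ (-3 : ℝ) =
      (1 / π) * (∫ x in Set.Ioi (0:ℝ), u x * x ^ (-2 : ℝ)) ^ 2 := by
  have hc := hu.continuous
  obtain ⟨K, hK⟩ := hu.lipschitzWith_of_hasCompactSupport hsupp one_ne_zero
  have hL : ∀ a b, |u a - u b| ≤ K * |a - b| := fun a b => by
    simpa [Real.dist_eq] using hK.dist_le_mul a b
  have hrhs : ∫ x in Ioi (0:ℝ), u x * x ^ (-2 : ℝ) = ∫ x in Ioi (0:ℝ), u x / x ^ 2 :=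
    setIntegral_congr_fun measurableSet_Ioi fun x hx => by
      simp only [rpow_neg (le_of_lt hx), rpow_ofNat, div_eq_mul_inv]
  have hlhs : ∫ x in Ioi (0:ℝ), u x * hilbertT u x * x ^ (-3 : ℝ) =
      -(2 / π) * ∫ x in Ioi (0:ℝ), u x / x ^ 2 / x * ∫ s in Ioo 0 1, foldedDiff u x s := by
    rw [← integral_const_mul]
    refine setIntegral_congr_fun measurableSet_Ioi fun x hx => ?_
    simp only [rpow_neg (le_of_lt hx), rpow_ofNat, hilbertT_eq hc hsupp heven hL h0 hpos hx]
    ring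
  rw [hrhs, hlhs]
  by_cases hv : IntegrableOn (fun x => u x / x ^ 2) (Ioi 0)
  · rw [← setIntegral_setIntegral_mul_foldedDiff hc hsupp hL h0 hpos hv]
    ring
  · -- both integrals diverge, and take the default value `0`
    rw [integral_undef hv, integral_undef fun hF =>
      hv (integrableOn_div_sq_of_integrableOn_mul_foldedDiff hc hsupp hL h0 hpos hF)]
    simp
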